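/- For every h ∈ ℝ and g ∈ ℝ with g ≠ 0, T(h, g) = ½Φ(h) + ½Φ(g h) − Φ(h)·Φ(g h) − T(g h, 1/g) − ½·1{ g < 0 }, where T is Owen's T function. -/

import Mathlib

open Real MeasureTheory

/-- Standard normal density. -/
noncomputable def stdNormalPdf (x : ℝ) : ℝ := Real.exp (-x ^ 2 / 2) / Real.sqrt (2 * Real.pi)

/-- Standard normal cumulative distribution function. -/
noncomputable def stdNormalCdf (x : ℝ) : ℝ := ∫ t in Set.Iic x, stdNormalPdf t

/-- Owen's T function. -/
noncomputable def owenT (h g : ℝ) : ℝ :=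
  (1 / (2 * Real.pi)) * ∫ t in (0:ℝ)..g, Real.exp (-h ^ 2 * (1 + t ^ 2) / 2) / (1 + t ^ 2)

theorem stdNormalPdf_eq (x : ℝ) :
    stdNormalPdf x = (√(2 * π))⁻¹ * Real.exp (-(1 / 2) * x ^ 2) := by
  rw [stdNormalPdf, div_eq_inv_mul]
  congr 2
  ring

theorem continuous_stdNormalPdf : Continuous stdNormalPdf := by
  unfold stdNormalPdf
  fun_prop

theorem integrable_stdNormalPdf : Integrable stdNormalPdf := by
  simp_rw [funext stdNormalPdf_eq]
  exact (integrable_exp_neg_mul_sq (by norm_num)).const_mul _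

theorem stdNormalCdf_zero : stdNormalCdf 0 = 1 / 2 := by
  have hsymm : stdNormalCdf 0 = ∫ t in Set.Ioi 0, stdNormalPdf t := by
    simpa [stdNormalPdf, stdNormalCdf] using integral_comp_neg_Iic (0 : ℝ) stdNormalPdf
  rw [hsymm]
  simp_rw [funext stdNormalPdf_eq]
  rw [integral_const_mul, integral_gaussian_Ioi]
  have h : π / (1 / 2) = 2 * π := by ring
  have hpos : √(2 * π) ≠ 0 := by positivity
  rw [h]
  field_simp

theorem stdNormalCdf_eq_add_integral (x : ℝ) :
    stdNormalCdf x = 1 / 2 + ∫ t in (0 : ℝ)..x, stdNormalPdf t := by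
  have h := intervalIntegral.integral_Iic_sub_Iic (a := 0) (b := x)
    integrable_stdNormalPdf.integrableOn integrable_stdNormalPdf.integrableOn
  rw [← h, ← stdNormalCdf_zero]
  unfold stdNormalCdf
  ring

theorem hasDerivAt_stdNormalCdf (x : ℝ) : HasDerivAt stdNormalCdf (stdNormalPdf x) x := by
  rw [funext stdNormalCdf_eq_add_integral]
  exact (continuous_stdNormalPdf.integral_hasStrictDerivAt 0 x).hasDerivAt.const_add _

/-- The partial derivative of Owen's T function in its first argument. -/
theorem hasDerivAt_owenT (h g : ℝ) :
    HasDerivAt (fun x => owenT x g) (-stdNormalPdf h * (stdNormalCdf (g * h) - 1 / 2)) h := by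
  have hcont (x : ℝ) :
      Continuous fun t : ℝ => Real.exp (-x ^ 2 * (1 + t ^ 2) / 2) / (1 + t ^ 2) :=
    Continuous.div (by fun_prop) (by fun_prop) fun t => by positivity
  have hderiv := (intervalIntegral.hasDerivAt_integral_of_dominated_loc_of_deriv_le
    (μ := volume) (a := 0) (b := g) (x₀ := h) (s := Metric.ball h 1)
    (F := fun x t : ℝ => Real.exp (-x ^ 2 * (1 + t ^ 2) / 2) / (1 + t ^ 2))
    (F' := fun x t : ℝ => -x * Real.exp (-x ^ 2 * (1 + t ^ 2) / 2))
    (bound := fun _ => |h| + 1)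
    (Metric.ball_mem_nhds h one_pos)
    (Filter.Eventually.of_forall fun x => (hcont x).aestronglyMeasurable)
    ((hcont h).intervalIntegrable _ _)
    (Continuous.aestronglyMeasurable (by fun_prop))
    (Filter.Eventually.of_forall fun t _ x hx => by
      have hx' : |x - h| < 1 := by simpa [Real.dist_eq] using hx
      have habs : |x| ≤ |h| + 1 := by
        have := abs_sub_abs_le_abs_sub x h
        linarith
      have hexp : Real.exp (-x ^ 2 * (1 + t ^ 2) / 2) ≤ 1 := by
        rw [Real.exp_le_one_iff]
        have : 0 ≤ x ^ 2 * (1 + t ^ 2) := by positivity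
        linarith
      rw [norm_mul, norm_neg, Real.norm_eq_abs, Real.norm_eq_abs, Real.abs_exp]
      exact (mul_le_of_le_one_right (abs_nonneg x) hexp).trans habs)
    intervalIntegrable_const
    (Filter.Eventually.of_forall fun t _ x _ => by
      have hpow : HasDerivAt (fun x : ℝ => -x ^ 2 * (1 + t ^ 2) / 2)
          (-(2 * x) * (1 + t ^ 2) / 2) x := by
        simpa using (((hasDerivAt_pow 2 x).neg.mul_const (1 + t ^ 2)).div_const 2)
      have hne : (1 + t ^ 2) ≠ 0 := by positivity
      refine (hpow.exp.div_const (1 + t ^ 2)).congr_deriv ?_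
      field_simp)).2.const_mul (1 / (2 * π))
  unfold owenT
  refine hderiv.congr_deriv ?_
  have hsubst := intervalIntegral.mul_integral_comp_mul_right (a := 0) (b := g) h
    (f := stdNormalPdf)
  rw [zero_mul] at hsubst
  rw [stdNormalCdf_eq_add_integral, ← hsubst, add_sub_cancel_left, ← mul_assoc,
    ← intervalIntegral.integral_const_mul, ← intervalIntegral.integral_const_mul]
  congr 1
  ext t
  have hsq : √(2 * π) * √(2 * π) = 2 * π := Real.mul_self_sqrt (by positivity)
  have hexp : Real.exp (-h ^ 2 * (1 + t ^ 2) / 2)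
      = Real.exp (-h ^ 2 / 2) * Real.exp (-(t * h) ^ 2 / 2) := by
    rw [← Real.exp_add]
    congr 1
    ring
  rw [hexp, ← hsq]
  simp only [stdNormalPdf]
  field_simp

theorem owenT_zero_left (g : ℝ) : owenT 0 g = Real.arctan g / (2 * π) := by
  simp [owenT]
  ring

theorem arctan_add_arctan_one_div {g : ℝ} (hg : g ≠ 0) :
    Real.arctan g + Real.arctan (1 / g) = π / 2 - π * (if g < 0 then 1 else 0) := by
  rw [one_div]
  rcases hg.lt_or_gt with h | h
  · rw [Real.arctan_inv_of_neg h, if_pos h]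
    ring
  · rw [Real.arctan_inv_of_pos h, if_neg h.not_gt]
    ring

theorem stmt11 (h g : ℝ) (hg : g ≠ 0) :
    owenT h g =
      (1 / 2) * stdNormalCdf h + (1 / 2) * stdNormalCdf (g * h)
        - stdNormalCdf h * stdNormalCdf (g * h)
        - owenT (g * h) (1 / g)
        - (1 / 2) * (if g < 0 then 1 else 0) := by
  let F : ℝ → ℝ := fun x => owenT x g + owenT (g * x) (1 / g)
    + (stdNormalCdf x - 1 / 2) * (stdNormalCdf (g * x) - 1 / 2)
  have hF (x : ℝ) : HasDerivAt F 0 x := by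
    have hmul : HasDerivAt (fun x : ℝ => g * x) g x := by
      simpa using (hasDerivAt_id x).const_mul g
    have hT := (hasDerivAt_owenT (g * x) (1 / g)).comp x hmul
    have hΦ := (hasDerivAt_stdNormalCdf (g * x)).comp x hmul
    have hgx : 1 / g * (g * x) = x := by field_simp
    rw [hgx] at hT
    refine (((hasDerivAt_owenT x g).add hT).add
      (((hasDerivAt_stdNormalCdf x).sub_const (1 / 2)).mul (hΦ.sub_const (1 / 2)))).congr_deriv ?_
    simp only [Function.comp_apply]
    ring
  have hconst : F h = F 0 :=
    is_const_of_deriv_eq_zero (fun x => (hF x).differentiableAt) (fun x => (hF x).deriv) h 0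
  have hzero : F 0 = (Real.arctan g + Real.arctan (1 / g)) / (2 * π) := by
    simp only [F, mul_zero, owenT_zero_left, stdNormalCdf_zero]
    ring
  rw [hzero, arctan_add_arctan_one_div hg] at hconst
  have hval : (π / 2 - π * (if g < 0 then 1 else 0)) / (2 * π)
      = 1 / 4 - 1 / 2 * (if g < 0 then 1 else 0) := by
    field_simp
    ring
  rw [hval] at hconst
  simp only [F] at hconst
  linarith
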